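/- Let x, y ∈ Σ and u ∈ Σ* be such that xuy ∈ MF(C^∞). Then xuy is not a C∞-word, both xu and uy are C∞-words, both x̄uy and xuȳ are C∞-words, u is left doubly extendable and right doubly extendable but not fully extendable, and u is a single-rooted maximal C∞-word. -/

import Mathlib

/- Common framework: words over the alphabet Σ = {1,2} (represented as natural
numbers), run-length encoding, the derivative D, k-differentiable words C^k,
C∞-words, heights, roots, primitives, minimal/maximal words, simple extensions,
minimal forbidden words, and the left frontier Ψ. -/

namespace CinftyWords

/-- A word is a finite sequence of natural numbers. -/
abbrev Word := List ℕ

/-- `w` is a word over the alphabet Σ = {1,2}. -/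
def IsWord (w : Word) : Prop := ∀ x ∈ w, x = 1 ∨ x = 2

/-- Complement of a letter: exchanges 1 and 2. -/
def bar (x : ℕ) : ℕ := 3 - x

/-- Letterwise complement of a word. -/
def comp (w : Word) : Word := w.map bar

/-- Run-length encoding Δ: the sequence of lengths of maximal runs of equal
consecutive letters. -/
def rle (w : Word) : Word := (w.splitBy (· == ·)).map List.length

/-- Drop the first run if it has length 1. -/
def dropFirstRun1 (g : List (List ℕ)) : List (List ℕ) :=
  match g with
  | [] => []
  | r :: rs => if r.length = 1 then rs else r :: rs

/-- The derivative `D w`: the run-length encoding of the word obtained from `w`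
by deleting its first and/or last run when that run has length 1. -/
def D (w : Word) : Word :=
  ((dropFirstRun1 ((dropFirstRun1 (w.splitBy (· == ·))).reverse)).reverse).map List.length

/-- `w` is differentiable: `w` is a word over Σ and so is its run-length encoding. -/
def Diffble (w : Word) : Prop := IsWord w ∧ IsWord (rle w)

/-- The set C^k of k-differentiable words: `D^[j] w` is differentiable for all `j < k`
(so that `D^[k] w` is defined). -/
def CK (k : ℕ) : Set Word := {w | IsWord w ∧ ∀ j < k, Diffble (D^[j] w)}

/-- The set C∞ of words differentiable arbitrarily many times. -/
def Cinf : Set Word := {w | ∀ k : ℕ, w ∈ CK k}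

/-- The height of a C∞-word: the least `k` with `D^[k] w = []`. -/
noncomputable def height (w : Word) : ℕ := sInf {k | D^[k] w = []}

/-- The root of a C∞-word: `D^[height w - 1] w`. -/
noncomputable def root (w : Word) : Word := D^[height w - 1] w

/-- `v` is a primitive of `w`: `v` is differentiable and `D v = w`. -/
def IsPrimitive (v w : Word) : Prop := Diffble v ∧ D v = w

/-- A nonempty C∞-word is maximal if each `D^[j] w` (for `j ≤ height w - 2`) is a
primitive of `D^[j+1] w` of maximal length (vacuously true when `height w = 1`). -/
def MaximalWord (w : Word) : Prop :=
  w ∈ Cinf ∧ w ≠ [] ∧ ∀ j, j + 2 ≤ height w →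
    ∀ v, IsPrimitive v (D^[j + 1] w) → v.length ≤ (D^[j] w).length

/-- A nonempty C∞-word is minimal if each `D^[j] w` (for `j ≤ height w - 2`) is a
primitive of `D^[j+1] w` of minimal length (vacuously true when `height w = 1`). -/
def MinimalWord (w : Word) : Prop :=
  w ∈ Cinf ∧ w ≠ [] ∧ ∀ j, j + 2 ≤ height w →
    ∀ v, IsPrimitive v (D^[j + 1] w) → (D^[j] w).length ≤ v.length

/-- `w` is right maximal: a suffix of a maximal word. -/
def RightMaximal (w : Word) : Prop := ∃ v, MaximalWord v ∧ w <:+ v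

/-- `w` is left maximal: a prefix of a maximal word. -/
def LeftMaximal (w : Word) : Prop := ∃ v, MaximalWord v ∧ w <+: v

/-- `w` is right minimal: a suffix of a minimal word. -/
def RightMinimal (w : Word) : Prop := ∃ v, MinimalWord v ∧ w <:+ v

/-- `w` is left minimal: a prefix of a minimal word. -/
def LeftMinimal (w : Word) : Prop := ∃ v, MinimalWord v ∧ w <+: v

/-- `w` is right doubly extendable: both `w1` and `w2` are C∞-words. -/
def RightDoublyExt (w : Word) : Prop := w ++ [1] ∈ Cinf ∧ w ++ [2] ∈ Cinf

/-- `w` is left doubly extendable: both `1w` and `2w` are C∞-words. -/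
def LeftDoublyExt (w : Word) : Prop := 1 :: w ∈ Cinf ∧ 2 :: w ∈ Cinf

/-- `w` is fully extendable: `1w1`, `1w2`, `2w1`, `2w2` are all C∞-words. -/
def FullyExt (w : Word) : Prop :=
  ∀ x, (x = 1 ∨ x = 2) → ∀ y, (y = 1 ∨ y = 2) → x :: (w ++ [y]) ∈ Cinf

/-- `w'` is a right simple extension of `w`: `w' = w ++ s` is a C∞-word and at each
step the extension by the complementary letter is not a C∞-word. -/
def RightSimpleExt (w w' : Word) : Prop :=
  w' ∈ Cinf ∧ ∃ s : Word, IsWord s ∧ w' = w ++ s ∧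
    ∀ i < s.length, w ++ s.take i ++ [bar (s.getD i 0)] ∉ Cinf

/-- `w'` is a left simple extension of `w`. -/
def LeftSimpleExt (w w' : Word) : Prop := RightSimpleExt w.reverse w'.reverse

/-- `w'` is a simple extension of `w`: a right simple extension of a left simple
extension of `w`. -/
def SimpleExt (w w' : Word) : Prop := ∃ v, LeftSimpleExt w v ∧ RightSimpleExt v w'

/-- `m` is the maximal extension of `w`: a simple extension of `w` of maximal length. -/
def IsMaximalExtension (w m : Word) : Prop :=
  SimpleExt w m ∧ ∀ v, SimpleExt w v → v.length ≤ m.length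

/-- A language is factorial if it is closed under taking factors. -/
def Factorial (F : Set Word) : Prop := ∀ v ∈ F, ∀ u, u <:+: v → u ∈ F

/-- A language is anti-factorial if no word of it is a proper factor of another
word of it. -/
def AntiFactorial (M : Set Word) : Prop := ∀ u ∈ M, ∀ v ∈ M, u ≠ v → ¬ u <:+: v

/-- The set of minimal forbidden words of a (factorial) language `F`: words not
in `F` whose maximal proper prefix and maximal proper suffix are both in `F`. -/
def MF (F : Set Word) : Set Word := {v | v ∉ F ∧ v.dropLast ∈ F ∧ v.tail ∈ F}

/-- The height of a minimal forbidden word of C∞: `k + 1`, where `k` is the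
(unique) integer such that `w` is k-differentiable and `D^[k] w ∈ {111, 222}`. -/
noncomputable def MFheight (w : Word) : ℕ :=
  sInf {k | w ∈ CK k ∧ (D^[k] w = [1, 1, 1] ∨ D^[k] w = [2, 2, 2])} + 1

/-- The left frontier Ψ of a C∞-word: the word of length `height w` over {0,1,2}
recording the first letter of each derivative, with `2` replaced by `0` when the
first two letters of the previous derivative are distinct. -/
noncomputable def psi (w : Word) : List ℕ :=
  (List.range (height w)).map (fun i =>
    if i = 0 then w.getD 0 0
    else if (D^[i] w).getD 0 0 = 2 ∧ (D^[i - 1] w).getD 0 0 ≠ (D^[i - 1] w).getD 1 0 then 0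
    else (D^[i] w).getD 0 0)

end CinftyWords

namespace CinftyWords

/-- Lengths of the runs of `a :: l` when `k` further copies of `a` precede it. -/
def runLengths : List ℕ → ℕ → ℕ → List ℕ
  | [], _, k => [k + 1]
  | b :: l, a, k => if a = b then runLengths l b (k + 1) else (k + 1) :: runLengths l b 0

lemma map_length_splitBy_loop (l : List ℕ) (a : ℕ) (g : List ℕ) (gs : List (List ℕ)) :
    (List.splitBy.loop (· == ·) l a g gs).map List.length =
      (gs.map List.length).reverse ++ runLengths l a g.length := by
  induction l generalizing a g gs with
  | nil => simp [List.splitBy.loop, runLengths]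
  | cons b l ih =>
    by_cases hab : a = b
    · simp [List.splitBy.loop, runLengths, hab, ih]
    · have : (a == b) = false := by simpa using hab
      simp [List.splitBy.loop, runLengths, hab, this, ih]

lemma rle_cons_eq (a : ℕ) (l : List ℕ) : rle (a :: l) = runLengths l a 0 := by
  simpa [rle, List.splitBy] using map_length_splitBy_loop l a [] []

lemma exists_runLengths (l : List ℕ) (a : ℕ) :
    ∃ n r, ∀ k, runLengths l a k = (n + k) :: r := by
  induction l generalizing a with
  | nil => exact ⟨1, [], fun k => by simp [runLengths, add_comm]⟩
  | cons b l ih =>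
    by_cases hab : a = b
    · obtain ⟨n, r, h⟩ := ih b
      exact ⟨n + 1, r, fun k => by simp [runLengths, hab, h]; omega⟩
    · exact ⟨1, runLengths l b 0, fun k => by simp [runLengths, hab, add_comm]⟩

lemma rle_cons_cons {b n : ℕ} {l r : List ℕ} (x : ℕ) (h : rle (b :: l) = n :: r) :
    rle (x :: b :: l) = if x = b then (n + 1) :: r else 1 :: n :: r := by
  obtain ⟨m, s, hs⟩ := exists_runLengths l b
  rw [rle_cons_eq, hs] at h
  obtain ⟨rfl, rfl⟩ := List.cons.inj h
  rw [rle_cons_eq]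
  split_ifs with hx <;> simp [runLengths, hx, hs]

lemma runLengths_append (l : List ℕ) (a k : ℕ) :
    ∃ c r n, (a = c ∨ c ∈ l) ∧ runLengths l a k = r ++ [n] ∧
      ∀ y, runLengths (l ++ [y]) a k = if y = c then r ++ [n + 1] else r ++ [n, 1] := by
  induction l generalizing a k with
  | nil =>
    refine ⟨a, [], k + 1, Or.inl rfl, rfl, fun y => ?_⟩
    by_cases hy : y = a
    · simp [runLengths, hy]
    · simp [runLengths, hy, Ne.symm hy]
  | cons b l ih =>
    by_cases hab : a = b
    · obtain ⟨c, r, n, hc, h₁, h₂⟩ := ih b (k + 1)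
      refine ⟨c, r, n, ?_, by simp [runLengths, hab, h₁], fun y => by simp [runLengths, hab, h₂]⟩
      grind
    · obtain ⟨c, r, n, hc, h₁, h₂⟩ := ih b 0
      refine ⟨c, (k + 1) :: r, n, ?_, by simp [runLengths, hab, h₁], fun y => ?_⟩
      · grind
      · simp only [List.cons_append, runLengths, hab, if_false, h₂]
        split_ifs <;> rfl

lemma rle_append_singleton {u : Word} (hu : u ≠ []) :
    ∃ c r n, c ∈ u ∧ rle u = r ++ [n] ∧
      ∀ y, rle (u ++ [y]) = if y = c then r ++ [n + 1] else r ++ [n, 1] := by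
  obtain ⟨b, l, rfl⟩ := List.exists_cons_of_ne_nil hu
  obtain ⟨c, r, n, hc, h₁, h₂⟩ := runLengths_append l b 0
  refine ⟨c, r, n, by grind, by rw [rle_cons_eq, h₁], fun y => ?_⟩
  rw [List.cons_append, rle_cons_eq, h₂]

lemma sum_rle (w : Word) : (rle w).sum = w.length := by
  rw [rle, ← List.length_flatten, List.flatten_splitBy]

/-- Drop the first letter if it equals 1. -/
def dropOne : Word → Word
  | [] => []
  | n :: l => if n = 1 then l else n :: l

lemma map_dropFirstRun1 (g : List (List ℕ)) :
    (dropFirstRun1 g).map List.length = dropOne (g.map List.length) := by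
  cases g with
  | nil => rfl
  | cons r g => by_cases h : r.length = 1 <;> simp [dropFirstRun1, dropOne, h]

lemma D_eq_dropOne (w : Word) : D w = (dropOne (dropOne (rle w)).reverse).reverse := by
  rw [D, List.map_reverse, map_dropFirstRun1, List.map_reverse, map_dropFirstRun1, rle]

lemma sum_le_sum_dropOne (l : Word) : l.sum ≤ (dropOne l).sum + 1 := by
  cases l with
  | nil => simp
  | cons n l => by_cases h : n = 1 <;> simp [dropOne, h]; omega

lemma length_le_sum_D (w : Word) : w.length ≤ (D w).sum + 2 := by
  have h₁ := sum_le_sum_dropOne (rle w)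
  have h₂ := sum_le_sum_dropOne (dropOne (rle w)).reverse
  rw [List.sum_reverse] at h₂
  rw [D_eq_dropOne, List.sum_reverse, ← sum_rle w]
  omega

lemma IsWord.length_le_sum {w : Word} (hw : IsWord w) : w.length ≤ w.sum := by
  refine List.length_le_sum_of_one_le w fun x hx => ?_
  rcases hw x hx with rfl | rfl <;> norm_num

lemma mem_Cinf_iff {w : Word} : w ∈ Cinf ↔ Diffble w ∧ D w ∈ Cinf := by
  constructor
  · intro h
    have h0 : ∀ j, Diffble (D^[j] w) := fun j => (h (j + 1)).2 j j.lt_succ_self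
    exact ⟨h0 0, fun k => ⟨(h0 1).1, fun j _ => h0 (j + 1)⟩⟩
  · rintro ⟨h₁, h₂⟩ k
    refine ⟨h₁.1, fun j hj => ?_⟩
    cases j with
    | zero => exact h₁
    | succ j => exact (h₂ (j + 1)).2 j j.lt_succ_self

lemma nil_mem_Cinf : ([] : Word) ∈ Cinf := by
  have h : ∀ j, D^[j] ([] : Word) = [] := fun j => Function.iterate_fixed rfl j
  refine fun k => ⟨by simp [IsWord], fun j _ => ?_⟩
  rw [h]
  simp [Diffble, IsWord, rle]

instance (w : Word) : Decidable (IsWord w) := by unfold IsWord; infer_instance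

instance (w : Word) : Decidable (Diffble w) := by unfold Diffble; infer_instance

lemma mem_Cinf_of_D_D_D_eq_nil {w : Word} (h₁ : Diffble w) (h₂ : Diffble (D w))
    (h₃ : Diffble (D (D w))) (h₄ : D (D (D w)) = []) : w ∈ Cinf :=
  mem_Cinf_iff.2 ⟨h₁, mem_Cinf_iff.2 ⟨h₂, mem_Cinf_iff.2 ⟨h₃, h₄ ▸ nil_mem_Cinf⟩⟩⟩

lemma height_eq_succ {w : Word} (hw : w ≠ []) (h : ∃ k, D^[k] w = []) :
    height w = height (D w) + 1 := by
  have hpos : 0 < height w := by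
    rw [Nat.pos_iff_ne_zero]
    intro h0
    rcases Nat.sInf_eq_zero.1 h0 with h1 | h1
    · exact hw h1
    · obtain ⟨k, hk⟩ := h
      exact h1.le hk
  exact (Nat.sInf_add (n := 1) (p := fun k => D^[k] w = []) hpos).symm

lemma exists_iterate_D_eq_nil_succ {w : Word} (h : ∃ k, D^[k] (D w) = []) :
    ∃ k, D^[k] w = [] :=
  let ⟨k, hk⟩ := h
  ⟨k + 1, hk⟩

lemma height_pos {w : Word} (hw : w ≠ []) (h : ∃ k, D^[k] w = []) : 0 < height w := by
  rw [height_eq_succ hw h]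
  exact Nat.succ_pos _

lemma root_eq_root_D {w : Word} (hw : w ≠ []) (hD : D w ≠ []) (h : ∃ k, D^[k] (D w) = []) :
    root w = root (D w) := by
  have hpos := height_pos hD h
  rw [root, root, height_eq_succ hw (exists_iterate_D_eq_nil_succ h)]
  obtain ⟨n, hn⟩ := Nat.exists_eq_succ_of_ne_zero hpos.ne'
  rw [hn]
  rfl

lemma MaximalWord.of_D {w : Word} (hw : w ≠ []) (hC : w ∈ Cinf) (hD : MaximalWord (D w))
    (h : ∃ k, D^[k] (D w) = []) (hlen : (D w).sum + 2 ≤ w.length) : MaximalWord w := by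
  refine ⟨hC, hw, fun j hj v hv => ?_⟩
  rw [height_eq_succ hw (exists_iterate_D_eq_nil_succ h)] at hj
  cases j with
  | zero =>
    have := length_le_sum_D v
    rw [hv.2] at this
    exact this.trans hlen
  | succ j => exact hD.2.2 j (by omega) v hv

/-- The letter prepended (or appended) to the derivative when `x` extends a run of length 1
of the letter `b` (value 2) or closes it (value 1). -/
def closing (x b : ℕ) : ℕ := if x = b then 2 else 1

lemma closing_eq (x b : ℕ) : closing x b = 1 ∨ closing x b = 2 := by
  unfold closing; split_ifs <;> simp

lemma closing_bar {x b : ℕ} (hx : x = 1 ∨ x = 2) (hb : b = 1 ∨ b = 2) :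
    closing (bar x) b = bar (closing x b) := by
  rcases hx with rfl | rfl <;> rcases hb with rfl | rfl <;> rfl

lemma bar_eq {x : ℕ} (hx : x = 1 ∨ x = 2) : bar x = 1 ∨ bar x = 2 := by
  rcases hx with rfl | rfl <;> simp [bar]

/-- A nonempty word either is a single run, or its run-length encoding and those of its one-letter
extensions are given by its outermost letters and the lengths of its outermost runs. -/
lemma rle_extensions {u : Word} (hu : u ≠ []) :
    (∃ n, rle u = [n]) ∨ ∃ b c n m k, b ∈ u ∧ c ∈ u ∧ rle u = n :: (m ++ [k]) ∧
      (∀ x, rle (x :: u) = (if x = b then [n + 1] else [1, n]) ++ m ++ [k]) ∧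
      (∀ y, rle (u ++ [y]) = [n] ++ m ++ (if y = c then [k + 1] else [k, 1])) ∧
      ∀ x y, rle (x :: (u ++ [y])) =
        (if x = b then [n + 1] else [1, n]) ++ m ++ (if y = c then [k + 1] else [k, 1]) := by
  obtain ⟨c, r, k, hc, h, hy⟩ := rle_append_singleton hu
  obtain ⟨b, l, rfl⟩ := List.exists_cons_of_ne_nil hu
  cases r with
  | nil => exact Or.inl ⟨k, h⟩
  | cons n m =>
    have hy' : ∀ y, rle (b :: l ++ [y]) = n :: (m ++ (if y = c then [k + 1] else [k, 1])) := by
      intro y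
      rw [hy]
      split_ifs <;> rfl
    refine Or.inr ⟨b, c, n, m, k, List.mem_cons_self, hc, h, fun x => ?_, hy', fun x y => ?_⟩
    · rw [rle_cons_cons x h]
      split_ifs <;> rfl
    · have := rle_cons_cons x (hy' y)
      refine this.trans ?_
      by_cases hx : x = b <;> simp [hx]

/-- The first and last runs of `u` have length 1 and `m` is the derivative of `u`; `b` and `c` are
the first and last letters of `u`. -/
structure IsSharp (u m : Word) (b c : ℕ) : Prop where
  ne_nil : u ≠ []
  mem_left : b ∈ u
  mem_right : c ∈ u
  rle_eq : rle u = 1 :: (m ++ [1])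
  rle_cons : ∀ x, rle (x :: u) = (if x = b then [2] else [1, 1]) ++ m ++ [1]
  rle_append : ∀ y, rle (u ++ [y]) = [1] ++ m ++ (if y = c then [2] else [1, 1])
  rle_cons_append : ∀ x y, rle (x :: (u ++ [y])) =
    (if x = b then [2] else [1, 1]) ++ m ++ (if y = c then [2] else [1, 1])

namespace IsSharp

variable {u m : Word} {b c : ℕ}

lemma D_eq (h : IsSharp u m b c) : D u = m := by
  simp [D_eq_dropOne, h.rle_eq, dropOne]

lemma D_cons (h : IsSharp u m b c) (x : ℕ) : D (x :: u) = closing x b :: m := by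
  rw [D_eq_dropOne, h.rle_cons, closing]
  split_ifs <;> simp [dropOne]

lemma D_append (h : IsSharp u m b c) (y : ℕ) : D (u ++ [y]) = m ++ [closing y c] := by
  rw [D_eq_dropOne, h.rle_append, closing]
  split_ifs <;> simp [dropOne]

lemma D_cons_append (h : IsSharp u m b c) (x y : ℕ) :
    D (x :: (u ++ [y])) = closing x b :: (m ++ [closing y c]) := by
  rw [D_eq_dropOne, h.rle_cons_append, closing, closing]
  split_ifs <;> simp [dropOne]

lemma length_eq (h : IsSharp u m b c) : u.length = m.sum + 2 := by
  rw [← sum_rle, h.rle_eq]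
  simp
  omega

lemma diffble (h : IsSharp u m b c) (hu : IsWord u) (hm : IsWord m) : Diffble u := by
  refine ⟨hu, ?_⟩
  rw [h.rle_eq]
  simp only [IsWord, List.mem_cons, List.mem_append] at hm ⊢
  grind

lemma diffble_cons (h : IsSharp u m b c) (hu : IsWord u) (hm : IsWord m) {x : ℕ}
    (hx : x = 1 ∨ x = 2) : Diffble (x :: u) := by
  refine ⟨?_, ?_⟩
  · simp only [IsWord, List.mem_cons] at hu ⊢
    grind
  rw [h.rle_cons]
  simp only [IsWord, List.mem_append] at hm ⊢
  grind

lemma diffble_append (h : IsSharp u m b c) (hu : IsWord u) (hm : IsWord m) {y : ℕ}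
    (hy : y = 1 ∨ y = 2) : Diffble (u ++ [y]) := by
  refine ⟨?_, ?_⟩
  · simp only [IsWord, List.mem_append] at hu ⊢
    grind
  rw [h.rle_append]
  simp only [IsWord, List.mem_append] at hm ⊢
  grind

lemma diffble_cons_append (h : IsSharp u m b c) (hu : IsWord u) (hm : IsWord m) {x y : ℕ}
    (hx : x = 1 ∨ x = 2) (hy : y = 1 ∨ y = 2) : Diffble (x :: (u ++ [y])) := by
  refine ⟨?_, ?_⟩
  · simp only [IsWord, List.mem_cons, List.mem_append] at hu ⊢
    grind
  rw [h.rle_cons_append]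
  simp only [IsWord, List.mem_append] at hm ⊢
  grind

end IsSharp

lemma mem_Cinf_of_length_two {x y : ℕ} (hx : x = 1 ∨ x = 2) (hy : y = 1 ∨ y = 2) :
    [x, y] ∈ Cinf := by
  rcases hx with rfl | rfl <;> rcases hy with rfl | rfl <;>
    exact mem_Cinf_of_D_D_D_eq_nil (by decide) (by decide) (by decide) (by decide)

lemma mem_Cinf_of_length_three {x b y : ℕ} (hx : x = 1 ∨ x = 2) (hb : b = 1 ∨ b = 2)
    (hy : y = 1 ∨ y = 2) (h : ¬ (b = x ∧ y = x)) : [x, b, y] ∈ Cinf := by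
  rcases hx with rfl | rfl <;> rcases hb with rfl | rfl <;> rcases hy with rfl | rfl <;>
    first
      | exact absurd ⟨rfl, rfl⟩ h
      | exact mem_Cinf_of_D_D_D_eq_nil (by decide) (by decide) (by decide) (by decide)

lemma mem_Cinf_of_square {x b y : ℕ} (hx : x = 1 ∨ x = 2) (hb : b = 1 ∨ b = 2)
    (hy : y = 1 ∨ y = 2) (hxb : x ≠ b) (hyb : y ≠ b) : [x, b, b, y] ∈ Cinf := by
  rcases hx with rfl | rfl <;> rcases hb with rfl | rfl <;> rcases hy with rfl | rfl <;>
    first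
      | exact absurd rfl hxb
      | exact absurd rfl hyb
      | exact mem_Cinf_of_D_D_D_eq_nil (by decide) (by decide) (by decide) (by decide)

/-- If `xuy` is minimal forbidden, then either `xuy` is a cube of a letter, or the first and last
runs of `u` have length 1. -/
lemma eq_singleton_or_isSharp {x y : ℕ} (hx : x = 1 ∨ x = 2) (hy : y = 1 ∨ y = 2) {u : Word}
    (hu : IsWord u) (hxuy : x :: (u ++ [y]) ∉ Cinf) (hxu : x :: u ∈ Cinf)
    (huy : u ++ [y] ∈ Cinf) :
    (u = [x] ∧ y = x) ∨ ∃ m b c, IsWord m ∧ IsSharp u m b c := by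
  have hne : u ≠ [] := by
    rintro rfl
    exact hxuy (mem_Cinf_of_length_two hx hy)
  have hxu' := (mem_Cinf_iff.1 hxu).1.2
  have huy' := (mem_Cinf_iff.1 huy).1.2
  have hword : IsWord (x :: (u ++ [y])) := by
    simp only [IsWord, List.mem_cons, List.mem_append] at hu ⊢
    grind
  rcases rle_extensions hne with ⟨n, hn⟩ | ⟨b, c, n, m, k, hb, hc, h, hl, hr, hlr⟩
  · left
    obtain ⟨b, l, rfl⟩ := List.exists_cons_of_ne_nil hne
    have hb := hu b List.mem_cons_self
    have hlen := sum_rle (b :: l)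
    rw [hn] at hlen
    rw [rle_cons_cons x hn] at hxu'
    have hn2 : n ≤ 2 := by
      by_cases hxb : x = b <;> simp [hxb, IsWord] at hxu' <;> omega
    match l with
    | [] =>
      by_contra hcon
      refine hxuy (mem_Cinf_of_length_three hx hb hy ?_)
      simpa using hcon
    | [d] =>
      exfalso
      obtain rfl : n = 2 := by simpa using hlen
      have hd : d = b := by
        rw [rle_cons_cons b (show rle [d] = [1] from rfl)] at hn
        by_contra hd
        simp [Ne.symm hd] at hn
      subst hd
      have hxd : x ≠ d := by
        rintro rfl
        simp [IsWord] at hxu'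
      have hyd : y ≠ d := by
        rintro rfl
        have : rle [y, y, y] = [3] := by simp [rle_cons_eq, runLengths]
        simp [this, IsWord] at huy'
      exact hxuy (mem_Cinf_of_square hx hb hy hxd hyd)
    | d :: e :: l => simp at hlen; omega
  · right
    rw [hl] at hxu'
    rw [hr] at huy'
    have hm : IsWord m := fun z hz => huy' z (by simp [hz])
    have hdiff : Diffble (x :: (u ++ [y])) := by
      refine ⟨hword, ?_⟩
      rw [hlr]
      simp only [IsWord, List.mem_append] at hxu' huy' ⊢
      grind
    have hn : n = 1 := by
      rcases huy' n (by simp) with hn | rfl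
      · exact hn
      · have hxb : x ≠ b := fun hxb => by simp [hxb, IsWord] at hxu'
        refine absurd (mem_Cinf_iff.2 ⟨hdiff, ?_⟩) hxuy
        convert (mem_Cinf_iff.1 huy).2 using 1
        rw [D_eq_dropOne, D_eq_dropOne, hlr, hr]
        simp [hxb, dropOne]
    have hk : k = 1 := by
      rcases hxu' k (by simp) with hk | rfl
      · exact hk
      · have hyc : y ≠ c := fun hyc => by
          rw [if_pos hyc] at huy'
          have := huy' 3 (by simp)
          omega
        refine absurd (mem_Cinf_iff.2 ⟨hdiff, ?_⟩) hxuy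
        convert (mem_Cinf_iff.1 hxu).2 using 1
        rw [D_eq_dropOne, D_eq_dropOne, hlr, hl]
        subst hn
        by_cases hxb : x = b <;> simp [hxb, hyc, dropOne]
    subst hn hk
    exact ⟨m, b, c, hm, hne, hb, hc, h, hl, hr, hlr⟩

lemma minimal_forbidden_aux (u : Word) {x y : ℕ} (hx : x = 1 ∨ x = 2) (hy : y = 1 ∨ y = 2)
    (hu : IsWord u) (hxuy : x :: (u ++ [y]) ∉ Cinf) (hxu : x :: u ∈ Cinf)
    (huy : u ++ [y] ∈ Cinf) :
    bar x :: (u ++ [y]) ∈ Cinf ∧ x :: (u ++ [bar y]) ∈ Cinf ∧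
      bar x :: u ∈ Cinf ∧ u ++ [bar y] ∈ Cinf ∧ u ∈ Cinf ∧
      (∃ k, D^[k] u = []) ∧ (root u).length = 1 ∧ MaximalWord u := by
  rcases eq_singleton_or_isSharp hx hy hu hxuy hxu huy with ⟨rfl, rfl⟩ | ⟨m, b, c, hm, h⟩
  · have hD : D [y] = [] := rfl
    have hC : [y] ∈ Cinf :=
      mem_Cinf_iff.2 ⟨⟨hu, by simp [IsWord, rle_cons_eq, runLengths]⟩, hD ▸ nil_mem_Cinf⟩
    have hex : ∃ k, D^[k] [y] = [] := ⟨1, rfl⟩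
    have hheight : height [y] = 1 := by
      rw [height_eq_succ (by simp) hex, hD]
      simp [height]
    have hbar : bar y ≠ y := by rcases hy with rfl | rfl <;> decide
    refine ⟨mem_Cinf_of_length_three (bar_eq hy) hy hy fun e => hbar e.1.symm,
      mem_Cinf_of_length_three hy hy (bar_eq hy) fun e => hbar e.2,
      mem_Cinf_of_length_two (bar_eq hy) hy, mem_Cinf_of_length_two hy (bar_eq hy), hC, hex,
      by simp [root, hheight], hC, by simp, fun j hj => by omega⟩
  · have hb := hu b h.mem_left
    have hc := hu c h.mem_right
    have hlen : m.length < u.length := by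
      have := hm.length_le_sum
      have := h.length_eq
      omega
    have hxuyD : closing x b :: (m ++ [closing y c]) ∉ Cinf := fun hcon =>
      hxuy (mem_Cinf_iff.2 ⟨h.diffble_cons_append hu hm hx hy, by rwa [h.D_cons_append]⟩)
    have hxuD := (mem_Cinf_iff.1 hxu).2
    have huyD := (mem_Cinf_iff.1 huy).2
    rw [h.D_cons] at hxuD
    rw [h.D_append] at huyD
    obtain ⟨h₁, h₂, h₃, h₄, h₅, h₆, h₇, h₈⟩ := minimal_forbidden_aux m
      (closing_eq x b) (closing_eq y c) hm hxuyD hxuD huyD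
    rw [← closing_bar hx hb] at h₁ h₃
    rw [← closing_bar hy hc] at h₂ h₄
    have hC : u ∈ Cinf := mem_Cinf_iff.2 ⟨h.diffble hu hm, by rwa [h.D_eq]⟩
    refine ⟨mem_Cinf_iff.2 ⟨h.diffble_cons_append hu hm (bar_eq hx) hy, by rwa [h.D_cons_append]⟩,
      mem_Cinf_iff.2 ⟨h.diffble_cons_append hu hm hx (bar_eq hy), by rwa [h.D_cons_append]⟩,
      mem_Cinf_iff.2 ⟨h.diffble_cons hu hm (bar_eq hx), by rwa [h.D_cons]⟩,
      mem_Cinf_iff.2 ⟨h.diffble_append hu hm (bar_eq hy), by rwa [h.D_append]⟩, hC, ?_, ?_, ?_⟩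
    · rw [← h.D_eq] at h₆
      exact exists_iterate_D_eq_nil_succ h₆
    · rw [root_eq_root_D h.ne_nil] <;> rw [h.D_eq]
      exacts [h₇, h₈.2.1, h₆]
    · apply MaximalWord.of_D h.ne_nil hC <;> rw [h.D_eq]
      exacts [h₈, h₆, h.length_eq.ge]
termination_by u.length

end CinftyWords

open CinftyWords in
/-- If `xuy ∈ MF(C∞)` with `x, y` letters of Σ and `u` a word over Σ, then `xuy` is not
a C∞-word, `xu`, `uy`, `x̄uy` and `xuȳ` are C∞-words, `u` is left doubly extendable and
right doubly extendable but not fully extendable, and `u` is a single-rooted maximal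
C∞-word. -/
theorem minimal_forbidden_word_structure (x y : ℕ) (hx : x = 1 ∨ x = 2)
    (hy : y = 1 ∨ y = 2) (u : Word) (hu : IsWord u)
    (h : x :: (u ++ [y]) ∈ MF Cinf) :
    x :: (u ++ [y]) ∉ Cinf ∧
    x :: u ∈ Cinf ∧ u ++ [y] ∈ Cinf ∧
    bar x :: (u ++ [y]) ∈ Cinf ∧ x :: (u ++ [bar y]) ∈ Cinf ∧
    LeftDoublyExt u ∧ RightDoublyExt u ∧ ¬ FullyExt u ∧
    u ∈ Cinf ∧ (root u).length = 1 ∧ MaximalWord u := by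
  obtain ⟨hxuy, hxu, huy⟩ := h
  rw [← List.cons_append, List.dropLast_concat] at hxu
  obtain ⟨h₁, h₂, h₃, h₄, h₅, -, h₇, h₈⟩ := minimal_forbidden_aux u hx hy hu hxuy hxu huy
  refine ⟨hxuy, hxu, huy, h₁, h₂, ?_, ?_, fun hf => hxuy (hf x hx y hy), h₅, h₇, h₈⟩
  · rcases hx with rfl | rfl
    exacts [⟨hxu, h₃⟩, ⟨h₃, hxu⟩]
  · rcases hy with rfl | rfl
    exacts [⟨huy, h₄⟩, ⟨h₄, huy⟩]
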